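/- Let R : 𝒳 → 𝒴 be an ε₀-DP local randomizer (i.e. (ε₀,0)-DP) with ε₀ > 0, let G be an undirected connected non-bipartite graph on n ≥ 3 vertices satisfying the mixing hypothesis with constant α ∈ (0,1), and suppose its stationary distribution satisfies π[v] ≥ 2/(n(n−2)) for every vertex v. Run the network-shuffle algorithm A_rnd-wlk with a number of rounds T ∈ ℕ with T ≥ (1/α)·ln(n^{4.5}/ε₀). Then for every δ ∈ [0,1] such that ε₀ ≤ ln(n/(16·ln(2/δ))), the algorithm A_rnd-wlk is (ε, e^{ε₀/(2n)}·δ)-differentially private, where ε = ε₀/n + ln(1 + ((e^{ε₀}−1)/(e^{ε₀}+1))·(8·√(e^{ε₀}·ln(4/δ))/√n + 8·e^{ε₀}/n)). -/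

import Mathlib

open scoped ENNReal BigOperators

noncomputable section

/-- Two datasets are neighboring if they differ in at most one coordinate. -/
def Neighboring {X : Type*} {n : ℕ} (x x' : Fin n → X) : Prop :=
  ∃ u₀ : Fin n, ∀ u : Fin n, u ≠ u₀ → x u = x' u

/-- Probability that a sample from `p` lands in `S`. -/
def prSet {Z : Type*} (p : PMF Z) (S : Set Z) : ℝ≥0∞ := p.toOuterMeasure S

/-- `(ε, δ)`-differential privacy of a randomized algorithm. -/
def IsDP {X Z : Type*} {n : ℕ} (A : (Fin n → X) → PMF Z) (ε δ : ℝ) : Prop :=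
  ∀ x x' : Fin n → X, Neighboring x x' → ∀ S : Set Z,
    prSet (A x) S ≤ ENNReal.ofReal (Real.exp ε) * prSet (A x') S + ENNReal.ofReal δ

/-- `(ε₀, δ₀)`-differential privacy of a local randomizer. -/
def IsLocalDP {X Y : Type*} (R : X → PMF Y) (ε₀ δ₀ : ℝ) : Prop :=
  ∀ x x' : X, ∀ S : Set Y,
    prSet (R x) S ≤ ENNReal.ofReal (Real.exp ε₀) * prSet (R x') S + ENNReal.ofReal δ₀

/-- Independent product of finitely many PMFs. -/
def pmfPi : {n : ℕ} → {Y : Type*} → (Fin n → PMF Y) → PMF (Fin n → Y)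
  | 0, _, _ => PMF.pure (fun i => i.elim0)
  | _ + 1, _, p =>
      (p 0).bind fun y => (pmfPi fun i => p i.succ).bind fun f => PMF.pure (Fin.cons y f)

/-- Given values together with destinations, form the tuple of multisets
`S v = {{ y_u : I_u = v }}`. -/
def partitionOutput {n : ℕ} {Y : Type*} (s : Fin n → Y × Fin n) : Fin n → Multiset Y :=
  fun v => (Finset.univ.val.filter fun u => (s u).2 = v).map fun u => (s u).1

/-- The network-shuffle algorithm: each client `u` independently samples `y_u ~ R (x u)` and a
destination `I_u ~ dest u`, and the output is the tuple of multisets `S v = {{ y_u : I_u = v }}`. -/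
def netShuffle {n : ℕ} {X Y : Type*} (R : X → PMF Y)
    (dest : Fin n → PMF (Fin n)) (x : Fin n → X) : PMF (Fin n → Multiset Y) :=
  (pmfPi fun u => (R (x u)).bind fun y => (dest u).map fun i => (y, i)).map partitionOutput

/-- The random-walk transition matrix `P = A D⁻¹` of a graph. -/
def transMatrix {n : ℕ} (G : SimpleGraph (Fin n)) [DecidableRel G.Adj] :
    Matrix (Fin n) (Fin n) ℝ :=
  fun u v => if G.Adj u v then ((G.degree v : ℝ))⁻¹ else 0

/-- The stationary distribution `π v = d_v / (2 m)`. -/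
def statDist {n : ℕ} (G : SimpleGraph (Fin n)) [DecidableRel G.Adj] : Fin n → ℝ :=
  fun v => (G.degree v : ℝ) / (2 * (G.edgeFinset.card : ℝ))

/-- Position distribution of a `T`-step random walk started at `u`: `P^T e_u`. -/
def walkVec {n : ℕ} (G : SimpleGraph (Fin n)) [DecidableRel G.Adj] (T : ℕ) (u : Fin n) :
    Fin n → ℝ :=
  (transMatrix G ^ T).mulVec fun j => if j = u then (1 : ℝ) else 0

/-- The mixing hypothesis: `‖P^t e_u − π‖₁ ≤ √n (1−α)^t` for all `u`, `t`. -/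
def MixHyp {n : ℕ} (G : SimpleGraph (Fin n)) [DecidableRel G.Adj] (α : ℝ) : Prop :=
  ∀ (u : Fin n) (t : ℕ),
    ∑ i, |walkVec G t u i - statDist G i| ≤ Real.sqrt n * (1 - α) ^ t

theorem prSet_eq_tsum {Z : Type*} (p : PMF Z) (S : Set Z) :
    prSet p S = ∑' z, S.indicator p z := by
  rw [prSet, PMF.toOuterMeasure_apply]

theorem prSet_le_one {Z : Type*} (p : PMF Z) (S : Set Z) : prSet p S ≤ 1 := by
  rw [prSet_eq_tsum, ← p.tsum_coe]
  exact ENNReal.tsum_le_tsum fun z => Set.indicator_le_self S _ z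

theorem prSet_singleton {Z : Type*} (p : PMF Z) (z : Z) : prSet p {z} = p z :=
  PMF.toOuterMeasure_apply_singleton p z

theorem prSet_le_mul_of_le {Z : Type*} {p q : PMF Z} {c : ℝ≥0∞} (h : ∀ z, p z ≤ c * q z)
    (S : Set Z) : prSet p S ≤ c * prSet q S := by
  rw [prSet_eq_tsum, prSet_eq_tsum, ← ENNReal.tsum_mul_left]
  refine ENNReal.tsum_le_tsum fun z => ?_
  by_cases hz : z ∈ S <;> simp [hz, h z]

theorem pmfPi_apply : ∀ {n : ℕ} {Y : Type*} (p : Fin n → PMF Y) (f : Fin n → Y),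
    pmfPi p f = ∏ i, p i (f i)
  | 0, Y, p, f => by
      have : f = fun i => i.elim0 := funext fun i => i.elim0
      simp [pmfPi, this]
  | n + 1, Y, p, f => by
      classical
      have key : ∀ y g, (p 0 y * (pmfPi (fun i => p i.succ) g *
          (PMF.pure (Fin.cons y g) : PMF (Fin (n + 1) → Y)) f))
          = if y = f 0 then (if g = Fin.tail f then
              p 0 y * pmfPi (fun i => p i.succ) g else 0) else 0 := by
        intro y g
        rw [PMF.pure_apply]
        have : (f = (Fin.cons y g : Fin (n + 1) → Y)) ↔ (y = f 0 ∧ g = Fin.tail f) := by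
          constructor
          · rintro rfl
            simp
          · rintro ⟨rfl, rfl⟩
            exact (Fin.cons_self_tail f).symm
        simp only [this]
        by_cases h1 : y = f 0 <;> by_cases h2 : g = Fin.tail f <;> simp [h1, h2]
      rw [pmfPi, PMF.bind_apply]
      simp_rw [PMF.bind_apply, ← ENNReal.tsum_mul_left, key]
      rw [tsum_eq_single (f 0), tsum_eq_single (Fin.tail f)]
      · simp [pmfPi_apply, Fin.prod_univ_succ, Fin.tail]
      · intro g hg; simp [hg]
      · intro y hy; simp [hy]

/-- The law of a product of mixtures is the mixture of the products. -/
theorem prSet_pmfPi_mixture {n : ℕ} {W ι : Type*} [Fintype ι] (μ : Fin n → PMF W)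
    (c : Fin n → ι → ℝ≥0∞) (ν : Fin n → ι → PMF W)
    (h : ∀ i w, μ i w = ∑ o, c i o * ν i o w) (S : Set (Fin n → W)) :
    prSet (pmfPi μ) S
      = ∑ l : Fin n → ι, (∏ i, c i (l i)) * prSet (pmfPi fun i => ν i (l i)) S := by
  classical
  simp_rw [prSet_eq_tsum, ← ENNReal.tsum_mul_left]
  rw [← Summable.tsum_finsetSum fun _ _ => ENNReal.summable]
  refine tsum_congr fun w => ?_
  by_cases hw : w ∈ S
  · simp only [Set.indicator_of_mem hw, pmfPi_apply, h, ← Finset.prod_mul_distrib]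
    rw [Finset.prod_univ_sum, Fintype.piFinset_univ]
  · simp [hw]

theorem prSet_pmfPi_comp_perm {n : ℕ} {W : Type*} (ν : Fin n → PMF W) (σ : Equiv.Perm (Fin n))
    {S : Set (Fin n → W)} (hS : ∀ w, w ∘ σ ∈ S ↔ w ∈ S) :
    prSet (pmfPi fun i => ν (σ i)) S = prSet (pmfPi ν) S := by
  classical
  rw [prSet_eq_tsum, prSet_eq_tsum, ← (Equiv.arrowCongr σ.symm (Equiv.refl W)).tsum_eq]
  refine tsum_congr fun w => ?_
  have hw : (Equiv.arrowCongr σ.symm (Equiv.refl W)) w = w ∘ σ := by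
    ext i; simp [Equiv.arrowCongr]
  rw [hw]
  by_cases h : w ∈ S
  · rw [Set.indicator_of_mem h, Set.indicator_of_mem ((hS w).2 h), pmfPi_apply, pmfPi_apply]
    exact Equiv.prod_comp σ fun i => ν i (w i)
  · rw [Set.indicator_of_notMem h, Set.indicator_of_notMem fun h' => h ((hS w).1 h')]

theorem PMF.exists_toReal_eq {W : Type*} {f : W → ℝ} (h0 : ∀ w, 0 ≤ f w) (h1 : HasSum f 1) :
    ∃ Q : PMF W, ∀ w, (Q w).toReal = f w := by
  refine ⟨⟨fun w => ENNReal.ofReal (f w), ?_⟩, fun w => ENNReal.toReal_ofReal (h0 w)⟩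
  have := ENNReal.ofReal_tsum_of_nonneg h0 h1.summable
  rw [h1.tsum_eq, ENNReal.ofReal_one] at this
  rw [this]
  exact ENNReal.summable.hasSum

theorem PMF.hasSum_toReal {W : Type*} (μ : PMF W) : HasSum (fun w => (μ w).toReal) 1 := by
  have := ENNReal.hasSum_toReal (f := μ) (by simp [μ.tsum_coe])
  rwa [← ENNReal.tsum_toReal_eq μ.apply_ne_top, μ.tsum_coe, ENNReal.toReal_one] at this

/-- Two distributions with likelihood ratios bounded by `E` are opposite mixtures, with weights
`E / (E + 1)` and `1 / (E + 1)`, of a common pair of distributions. -/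
theorem PMF.exists_mixture_pair {W : Type*} {E : ℝ} (hE : 1 < E) (μ μ' : PMF W)
    (h : ∀ w, (μ w).toReal ≤ E * (μ' w).toReal) (h' : ∀ w, (μ' w).toReal ≤ E * (μ w).toReal) :
    ∃ Q Q' : PMF W, ∀ w,
      (μ w).toReal = E / (E + 1) * (Q w).toReal + 1 / (E + 1) * (Q' w).toReal ∧
      (μ' w).toReal = 1 / (E + 1) * (Q w).toReal + E / (E + 1) * (Q' w).toReal := by
  have hE1 : E - 1 ≠ 0 := by linarith
  have hE2 : E + 1 ≠ 0 := by linarith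
  have aux : ∀ ρ ρ' : PMF W, (∀ w, (ρ' w).toReal ≤ E * (ρ w).toReal) →
      ∃ Q : PMF W, ∀ w, (Q w).toReal = (E * (ρ w).toReal - (ρ' w).toReal) / (E - 1) := by
    intro ρ ρ' hρ
    refine PMF.exists_toReal_eq
      (fun w => div_nonneg (by linarith [hρ w]) (by linarith)) ?_
    have := ((ρ.hasSum_toReal.mul_left E).sub ρ'.hasSum_toReal).div_const (E - 1)
    rwa [mul_one, div_self hE1] at this
  obtain ⟨Q, hQ⟩ := aux μ μ' h'
  obtain ⟨Q', hQ'⟩ := aux μ' μ h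
  refine ⟨Q, Q', fun w => ?_⟩
  rw [hQ, hQ']
  constructor <;> field_simp <;> ring

/-- Removing the fraction `p` of a mixture component from a distribution that dominates it. -/
theorem PMF.exists_mixture_residual {W : Type*} {p : ℝ} (hp : p < 1) (μ κ : PMF W)
    (h : ∀ w, p * (κ w).toReal ≤ (μ w).toReal) :
    ∃ Q : PMF W, ∀ w, (μ w).toReal = p * (κ w).toReal + (1 - p) * (Q w).toReal := by
  have hp1 : 1 - p ≠ 0 := by linarith
  obtain ⟨Q, hQ⟩ := PMF.exists_toReal_eq (W := W)
    (f := fun w => ((μ w).toReal - p * (κ w).toReal) / (1 - p))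
    (fun w => div_nonneg (by linarith [h w]) (by linarith)) (by
      have := (μ.hasSum_toReal.sub (κ.hasSum_toReal.mul_left p)).div_const (1 - p)
      rwa [mul_one, div_self hp1] at this)
  refine ⟨Q, fun w => ?_⟩
  rw [hQ]
  field_simp
  ring

/-- If `G` does not see which of the coordinates with a label carries the label of `u₀`, then a
statistic of the label at `u₀` can be replaced by its average over all labelled coordinates. -/
theorem sum_mul_label_eq_sum_mul_average {V β : Type*} [Fintype V] [DecidableEq V] [Fintype β]
    [DecidableEq β] (u₀ : V) (G : (V → Option β) → ℝ) (h : Option β → ℝ) (h_none : h none = 0)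
    (hG : ∀ l j, l u₀ ≠ none → l j ≠ none → G (l ∘ Equiv.swap u₀ j) = G l)
    (hG0 : ∀ l, l u₀ = none → G l = 0) :
    ∑ l, G l * h (l u₀)
      = ∑ l, G l * ((∑ j, h (l j)) / ∑ j, if l j = none then (0 : ℝ) else 1) := by
  set s : (V → Option β) → ℝ := fun l => ∑ j, if l j = none then (0 : ℝ) else 1 with hs
  have s_pos : ∀ l, l u₀ ≠ none → 0 < s l := by
    intro l hl
    refine Finset.sum_pos' (fun j _ => by split_ifs <;> norm_num) ⟨u₀, Finset.mem_univ _, ?_⟩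
    simp [hl]
  have s_swap : ∀ l j, s (l ∘ Equiv.swap u₀ j) = s l := fun l j =>
    Equiv.sum_comp (Equiv.swap u₀ j) fun i => if l i = none then (0 : ℝ) else 1
  have key : ∀ j, ∑ l, G l * (h (l j) / s l)
      = ∑ l, G l * (h (l u₀) * (if l j = none then (0 : ℝ) else 1) / s l) := by
    intro j
    have hinv : Function.Involutive fun l : V → Option β => l ∘ Equiv.swap u₀ j := by
      intro l
      ext1 i
      simp
    rw [← Equiv.sum_comp hinv.toPerm]
    refine Finset.sum_congr rfl fun l _ => ?_
    simp only [Function.Involutive.coe_toPerm, s_swap]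
    have e1 : (l ∘ Equiv.swap u₀ j) j = l u₀ := by simp
    have e2 : (l ∘ Equiv.swap u₀ j) u₀ = l j := by simp
    rw [e1]
    by_cases hu : l u₀ = none
    · simp [hu, h_none]
    by_cases hj : l j = none
    · simp [hj, hG0 _ (e2.trans hj)]
    · simp [hj, hG l j hu hj]
  calc ∑ l, G l * h (l u₀)
      = ∑ l, ∑ j, G l * (h (l u₀) * (if l j = none then (0 : ℝ) else 1) / s l) := by
        refine Finset.sum_congr rfl fun l _ => ?_
        rw [← Finset.mul_sum, ← Finset.sum_div, ← Finset.mul_sum]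
        by_cases hu : l u₀ = none
        · simp [hG0 l hu]
        · rw [mul_div_cancel_right₀ _ (s_pos l hu).ne']
    _ = ∑ j, ∑ l, G l * (h (l j) / s l) := by
        rw [Finset.sum_comm]
        exact Finset.sum_congr rfl fun j _ => (key j).symm
    _ = _ := by
        rw [Finset.sum_comm]
        refine Finset.sum_congr rfl fun l _ => ?_
        rw [← Finset.mul_sum, Finset.sum_div]

/-- The `(ε, δ)` comparison of the label counts, up to a Chernoff error term. -/
theorem label_average_le {a b q t θ : ℝ} (ha : 0 ≤ a) (hb : 0 ≤ b) (hab : 0 < a + b)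
    (hq : 1 / 2 ≤ q) (hq1 : q ≤ 1) (hθ0 : 0 ≤ θ) (hθ : θ ≤ 1 / 2) (ht : 4 * θ ≤ t) :
    (q * a + (1 - q) * b) / (a + b)
      ≤ (1 + (2 * q - 1) * t) * (((1 - q) * a + q * b) / (a + b))
        + (q * a + (1 - q) * b) / (a + b) * Real.exp (θ * (a - b) - θ ^ 2 * (a + b)) := by
  have hA : 0 ≤ q * a + (1 - q) * b :=
    add_nonneg (mul_nonneg (by linarith) ha) (mul_nonneg (by linarith) hb)
  have hB : 0 ≤ (1 - q) * a + q * b :=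
    add_nonneg (mul_nonneg (by linarith) ha) (mul_nonneg (by linarith) hb)
  have hκ : 0 ≤ (2 * q - 1) * t := mul_nonneg (by linarith) (by linarith)
  rcases le_or_gt (a - b) (θ * (a + b)) with hd | hd
  · have : q * a + (1 - q) * b ≤ (1 + (2 * q - 1) * t) * ((1 - q) * a + q * b) := by
      have h1 : a - b ≤ t * ((1 - q) * a + q * b) := by
        rcases le_or_gt a b with hle | hlt
        · exact (sub_nonpos.2 hle).trans (mul_nonneg (by linarith) hB)
        · have h2 : b ≤ (1 - q) * a + q * b := by nlinarith
          have h3 : (a + b) / 4 ≤ b := by nlinarith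
          calc a - b ≤ 4 * θ * ((a + b) / 4) := by linarith
            _ ≤ t * ((1 - q) * a + q * b) :=
              mul_le_mul ht (h3.trans h2) (by linarith) (by linarith)
      have := mul_le_mul_of_nonneg_left h1 (show 0 ≤ 2 * q - 1 by linarith)
      nlinarith
    rw [← mul_div_assoc]
    have h4 : (q * a + (1 - q) * b) / (a + b)
        ≤ (1 + (2 * q - 1) * t) * ((1 - q) * a + q * b) / (a + b) :=
      div_le_div_of_nonneg_right this hab.le
    have h5 : 0 ≤ (q * a + (1 - q) * b) / (a + b)
        * Real.exp (θ * (a - b) - θ ^ 2 * (a + b)) :=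
      mul_nonneg (div_nonneg hA hab.le) (Real.exp_pos _).le
    linarith
  · have h1 : 1 ≤ Real.exp (θ * (a - b) - θ ^ 2 * (a + b)) :=
      Real.one_le_exp (by nlinarith)
    have h2 : 0 ≤ (q * a + (1 - q) * b) / (a + b) := div_nonneg hA hab.le
    have h3 : 0 ≤ (1 + (2 * q - 1) * t) * (((1 - q) * a + q * b) / (a + b)) :=
      mul_nonneg (by linarith) (div_nonneg hB hab.le)
    nlinarith

/-- Label weights: weight `p` split evenly between the two labels, the rest on `none`. -/
def labelWeight (p : ℝ) : Option Bool → ℝ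
  | none => 1 - p
  | some _ => p / 2

/-- The statistic with value `a` on `true`, `b` on `false` and `0` on `none`. -/
def labelStat (a b : ℝ) : Option Bool → ℝ
  | none => 0
  | some true => a
  | some false => b

theorem sum_labelStat {V : Type*} [Fintype V] (a b : ℝ) (l : V → Option Bool) :
    ∑ j, labelStat a b (l j)
      = a * ∑ j, labelStat 1 0 (l j) + b * ∑ j, labelStat 0 1 (l j) := by
  rw [Finset.mul_sum, Finset.mul_sum, ← Finset.sum_add_distrib]
  refine Finset.sum_congr rfl fun j _ => ?_
  rcases l j with _ | _ | _ <;> simp [labelStat]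

theorem sum_ite_none {V : Type*} [Fintype V] (l : V → Option Bool) :
    (∑ j, if l j = none then (0 : ℝ) else 1)
      = ∑ j, labelStat 1 0 (l j) + ∑ j, labelStat 0 1 (l j) := by
  rw [← Finset.sum_add_distrib]
  refine Finset.sum_congr rfl fun j _ => ?_
  rcases l j with _ | _ | _ <;> simp [labelStat]

/-- Exponential moment of the difference of the label counts. -/
theorem sum_label_exp_le {V : Type*} [Fintype V] [DecidableEq V] (u₀ : V) {p q θ : ℝ}
    (hp0 : 0 ≤ p) (hp1 : p ≤ 1) (hq0 : 0 ≤ q) (hq1 : q ≤ 1) (hθ : 0 ≤ θ) :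
    ∑ l : V → Option Bool, (∏ i ∈ Finset.univ.erase u₀, labelWeight p (l i))
        * labelStat q (1 - q) (l u₀)
        * Real.exp (∑ j, labelStat (θ - θ ^ 2) (-θ - θ ^ 2) (l j))
      ≤ Real.exp (θ - θ ^ 2
          - ((Fintype.card V : ℝ) - 1) * p * (1 - Real.exp (-(θ ^ 2 / 2)))) := by
  set e : Option Bool → ℝ := fun o => Real.exp (labelStat (θ - θ ^ 2) (-θ - θ ^ 2) o) with he
  set f : V → Option Bool → ℝ := fun i o =>
    (if i = u₀ then labelStat q (1 - q) o else labelWeight p o) * e o with hf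
  have h1 : ∀ l : V → Option Bool, (∏ i ∈ Finset.univ.erase u₀, labelWeight p (l i))
        * labelStat q (1 - q) (l u₀)
        * Real.exp (∑ j, labelStat (θ - θ ^ 2) (-θ - θ ^ 2) (l j)) = ∏ i, f i (l i) := by
    intro l
    rw [Real.exp_sum, Finset.prod_mul_distrib]
    congr 1
    conv_rhs => rw [← Finset.prod_erase_mul _ _ (Finset.mem_univ u₀), if_pos rfl]
    congr 1
    exact Finset.prod_congr rfl fun i hi => by rw [if_neg (Finset.ne_of_mem_erase hi)]
  simp_rw [h1]
  have h2 : ∑ l : V → Option Bool, ∏ i, f i (l i) = ∏ i, ∑ o, f i o := by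
    rw [Finset.prod_univ_sum, Fintype.piFinset_univ]
  rw [h2, ← Finset.prod_erase_mul _ _ (Finset.mem_univ u₀)]
  have hx : Real.exp (-θ - θ ^ 2) ≤ Real.exp (θ - θ ^ 2) := Real.exp_le_exp.2 (by linarith)
  have h3 : ∑ o, f u₀ o ≤ Real.exp (θ - θ ^ 2) := by
    simp only [hf, he, if_true, Fintype.sum_option, Fintype.sum_bool, labelStat]
    nlinarith
  have h30 : 0 ≤ ∑ o, f u₀ o := by
    simp only [hf, he, if_true, Fintype.sum_option, Fintype.sum_bool, labelStat, zero_mul, zero_add]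
    have := sub_nonneg.2 hq1
    positivity
  have h4 : ∀ i ∈ Finset.univ.erase u₀,
      ∑ o, f i o ≤ Real.exp (-(p * (1 - Real.exp (-(θ ^ 2 / 2))))) := by
    intro i hi
    simp only [hf, he, if_neg (Finset.ne_of_mem_erase hi), Fintype.sum_option, Fintype.sum_bool,
      labelStat, labelWeight, Real.exp_zero]
    have hc : Real.exp (θ - θ ^ 2) + Real.exp (-θ - θ ^ 2) ≤ 2 * Real.exp (-(θ ^ 2 / 2)) := by
      have e1 : Real.exp (θ - θ ^ 2) + Real.exp (-θ - θ ^ 2)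
          = 2 * (Real.exp (-θ ^ 2) * Real.cosh θ) := by
        rw [Real.cosh_eq, sub_eq_add_neg, sub_eq_add_neg, Real.exp_add, Real.exp_add]
        ring
      have e2 : Real.exp (-(θ ^ 2 / 2)) = Real.exp (-θ ^ 2) * Real.exp (θ ^ 2 / 2) := by
        rw [← Real.exp_add]; ring_nf
      rw [e1, e2]
      gcongr
      exact Real.cosh_le_exp_half_sq θ
    have := Real.add_one_le_exp (-(p * (1 - Real.exp (-(θ ^ 2 / 2)))))
    nlinarith
  have h40 : ∀ i ∈ Finset.univ.erase u₀, 0 ≤ ∑ o, f i o := by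
    intro i hi
    simp only [hf, he, if_neg (Finset.ne_of_mem_erase hi), Fintype.sum_option, Fintype.sum_bool,
      labelStat, labelWeight]
    have := sub_nonneg.2 hp1
    positivity
  have hcard : 1 ≤ Fintype.card V := Fintype.card_pos_iff.2 ⟨u₀⟩
  calc _ ≤ (∏ i ∈ Finset.univ.erase u₀, Real.exp (-(p * (1 - Real.exp (-(θ ^ 2 / 2))))))
          * Real.exp (θ - θ ^ 2) :=
        mul_le_mul (Finset.prod_le_prod h40 h4) h3 h30 (by positivity)
    _ = _ := by
        rw [Finset.prod_const, Finset.card_erase_of_mem (Finset.mem_univ _), Finset.card_univ,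
          ← Real.exp_nat_mul, ← Real.exp_add, Nat.cast_sub hcard]
        congr 1
        push_cast
        ring

theorem labelWeight_nonneg {p : ℝ} (hp0 : 0 ≤ p) (hp1 : p ≤ 1) : ∀ o, 0 ≤ labelWeight p o
  | none => sub_nonneg.2 hp1
  | some _ => div_nonneg hp0 zero_le_two

theorem labelStat_nonneg {a b : ℝ} (ha : 0 ≤ a) (hb : 0 ≤ b) : ∀ o, 0 ≤ labelStat a b o
  | none => le_rfl
  | some true => ha
  | some false => hb

/-- Exchanging the roles of the two labels at `u₀` is hidden by the random labels elsewhere. -/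
theorem sum_labels_le_swapped {V : Type*} [Fintype V] [DecidableEq V] (u₀ : V) {p q t θ : ℝ}
    (hp0 : 0 ≤ p) (hp1 : p ≤ 1) (hq : 1 / 2 ≤ q) (hq1 : q ≤ 1) (hθ0 : 0 ≤ θ) (hθ : θ ≤ 1 / 2)
    (ht : 4 * θ ≤ t) (F : (V → Option Bool) → ℝ) (hF0 : ∀ l, 0 ≤ F l) (hF1 : ∀ l, F l ≤ 1)
    (hF : ∀ l j, l u₀ ≠ none → l j ≠ none → F (l ∘ Equiv.swap u₀ j) = F l) :
    ∑ l, (∏ i ∈ Finset.univ.erase u₀, labelWeight p (l i)) * labelStat q (1 - q) (l u₀) * F l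
      ≤ (1 + (2 * q - 1) * t) *
          ∑ l, (∏ i ∈ Finset.univ.erase u₀, labelWeight p (l i)) * labelStat (1 - q) q (l u₀) * F l
        + Real.exp (θ - θ ^ 2
          - ((Fintype.card V : ℝ) - 1) * p * (1 - Real.exp (-(θ ^ 2 / 2)))) := by
  set w : (V → Option Bool) → ℝ := fun l => ∏ i ∈ Finset.univ.erase u₀, labelWeight p (l i)
    with hw
  have hw0 : ∀ l, 0 ≤ w l := fun l => Finset.prod_nonneg fun i _ => labelWeight_nonneg hp0 hp1 _
  have hw_swap : ∀ l j, l u₀ ≠ none → l j ≠ none → w (l ∘ Equiv.swap u₀ j) = w l := by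
    intro l j hu hj
    refine Finset.prod_congr rfl fun i hi => ?_
    have hiu := Finset.ne_of_mem_erase hi
    by_cases hij : i = j
    · subst hij
      obtain ⟨x, hx⟩ := Option.ne_none_iff_exists'.1 hu
      obtain ⟨y, hy⟩ := Option.ne_none_iff_exists'.1 hj
      simp [hx, hy, labelWeight]
    · simp [Equiv.swap_apply_of_ne_of_ne hiu hij]
  set r : (V → Option Bool) → ℝ :=
    fun l => Real.exp (∑ j, labelStat (θ - θ ^ 2) (-θ - θ ^ 2) (l j)) with hr
  have hr_swap : ∀ l j, r (l ∘ Equiv.swap u₀ j) = r l := fun l j =>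
    congrArg Real.exp
      (Equiv.sum_comp (Equiv.swap u₀ j) fun i => labelStat (θ - θ ^ 2) (-θ - θ ^ 2) (l i))
  have sym : ∀ (H : (V → Option Bool) → ℝ) (a b : ℝ),
      (∀ l j, l u₀ ≠ none → l j ≠ none → H (l ∘ Equiv.swap u₀ j) = H l) →
      ∑ l, w l * labelStat a b (l u₀) * H l
        = ∑ l, (if l u₀ = none then 0 else w l * H l) * ((∑ j, labelStat a b (l j))
            / ∑ j, if l j = none then (0 : ℝ) else 1) := by
    intro H a b hH
    rw [← sum_mul_label_eq_sum_mul_average u₀ (fun l => if l u₀ = none then 0 else w l * H l)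
      (labelStat a b) rfl]
    · refine Finset.sum_congr rfl fun l _ => ?_
      by_cases hu : l u₀ = none
      · simp [hu, labelStat]
      · rw [if_neg hu]; ring
    · intro l j hu hj
      have e : (l ∘ Equiv.swap u₀ j) u₀ = l j := by simp
      simp only [e, if_neg hj, if_neg hu, hw_swap l j hu hj, hH l j hu hj]
    · intro l hu
      simp [hu]
  refine le_trans ?_ (add_le_add_right (sum_label_exp_le u₀ hp0 hp1 (by linarith) hq1 hθ0) _)
  rw [sym F _ _ hF, sym F _ _ hF, sym r _ _ fun l j _ _ => hr_swap l j, Finset.mul_sum,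
    ← Finset.sum_add_distrib]
  refine Finset.sum_le_sum fun l _ => ?_
  by_cases hu : l u₀ = none
  · simp [hu]
  simp only [if_neg hu, hr, sum_ite_none, sum_labelStat q, sum_labelStat (1 - q),
    sum_labelStat (θ - θ ^ 2)]
  set a := ∑ j, labelStat 1 0 (l j) with ha
  set b := ∑ j, labelStat 0 1 (l j) with hb
  have ha0 : 0 ≤ a := Finset.sum_nonneg fun j _ => labelStat_nonneg zero_le_one le_rfl _
  have hb0 : 0 ≤ b := Finset.sum_nonneg fun j _ => labelStat_nonneg le_rfl zero_le_one _
  have hab : 0 < a + b := by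
    rw [ha, hb, ← sum_ite_none]
    exact Finset.sum_pos' (fun j _ => by split_ifs <;> norm_num)
      ⟨u₀, Finset.mem_univ _, by simp [hu]⟩
  have main := label_average_le ha0 hb0 hab hq hq1 hθ0 hθ ht
  have hA : 0 ≤ (q * a + (1 - q) * b) / (a + b) :=
    div_nonneg (add_nonneg (mul_nonneg (by linarith) ha0) (mul_nonneg (by linarith) hb0)) hab.le
  have hexp : (θ - θ ^ 2) * a + (-θ - θ ^ 2) * b = θ * (a - b) - θ ^ 2 * (a + b) := by ring
  rw [hexp]
  set x := Real.exp (θ * (a - b) - θ ^ 2 * (a + b)) with hx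
  have hx0 : 0 < x := Real.exp_pos _
  have h1 := mul_le_mul_of_nonneg_left main (mul_nonneg (hw0 l) (hF0 l))
  have h2 : w l * F l * ((q * a + (1 - q) * b) / (a + b) * x)
      ≤ w l * 1 * ((q * a + (1 - q) * b) / (a + b) * x) := by
    have := hw0 l
    have := hF1 l
    gcongr
  linarith

/-- Privacy amplification for events that do not depend on the order of the reports. -/
theorem prSet_pmfPi_le_of_perm_invariant {W : Type*} {n : ℕ} (μ μ' : Fin n → PMF W) (u₀ : Fin n)
    (hagree : ∀ u, u ≠ u₀ → μ u = μ' u) {E t θ : ℝ} (hE : 1 < E)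
    (h₀ : ∀ i w, (μ u₀ w).toReal ≤ E * (μ' i w).toReal)
    (h₁ : ∀ i w, (μ' u₀ w).toReal ≤ E * (μ i w).toReal)
    (hθ0 : 0 ≤ θ) (hθ : θ ≤ 1 / 2) (ht : 4 * θ ≤ t)
    (S : Set (Fin n → W)) (hS : ∀ (σ : Equiv.Perm (Fin n)) w, w ∘ σ ∈ S ↔ w ∈ S) :
    (prSet (pmfPi μ) S).toReal
      ≤ (1 + (E - 1) / (E + 1) * t) * (prSet (pmfPi μ') S).toReal
        + Real.exp (θ - θ ^ 2 - ((n : ℝ) - 1) * E⁻¹ * (1 - Real.exp (-(θ ^ 2 / 2)))) := by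
  have hE0 : 0 < E := by linarith
  have hp0 : 0 ≤ E⁻¹ := inv_nonneg.2 hE0.le
  have hp1 : E⁻¹ < 1 := inv_lt_one_of_one_lt₀ hE
  set q := E / (E + 1) with hq
  have hq' : 1 - q = 1 / (E + 1) := by rw [hq]; field_simp; ring
  have hq1 : q ≤ 1 := by
    have : 0 ≤ 1 / (E + 1) := by positivity
    linarith
  have hq2 : 1 / 2 ≤ q := by
    rw [hq, div_le_div_iff₀ two_pos (by linarith)]
    linarith
  have hq3 : (E - 1) / (E + 1) = 2 * q - 1 := by rw [hq]; field_simp; ring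
  obtain ⟨Q, Q', hQ⟩ := PMF.exists_mixture_pair hE (μ u₀) (μ' u₀) (h₀ u₀) (h₁ u₀)
  have avg : ∀ w, ((Q w).toReal + (Q' w).toReal) / 2
      = ((μ u₀ w).toReal + (μ' u₀ w).toReal) / 2 := by
    intro w
    rw [(hQ w).1, (hQ w).2]
    field_simp
    ring
  obtain ⟨κ, hκ⟩ := PMF.exists_toReal_eq (f := fun w => ((Q w).toReal + (Q' w).toReal) / 2)
    (fun w => by positivity) (by
      have := (Q.hasSum_toReal.add Q'.hasSum_toReal).div_const 2
      norm_num at this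
      exact this)
  have hres : ∀ i, ∃ P : PMF W, i ≠ u₀ → ∀ w,
      (μ i w).toReal = E⁻¹ * (κ w).toReal + (1 - E⁻¹) * (P w).toReal := by
    intro i
    by_cases hi : i = u₀
    · exact ⟨Q, fun h => absurd hi h⟩
    obtain ⟨P, hP⟩ := PMF.exists_mixture_residual hp1 (μ i) κ fun w => by
      rw [hκ, avg, inv_mul_le_iff₀ hE0]
      have a := h₀ i w
      have b := h₁ i w
      rw [← hagree i hi] at a
      linarith
    exact ⟨P, fun _ => hP⟩
  choose P hP using hres
  set ν : Fin n → Option Bool → PMF W := fun i o => match o with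
    | none => P i
    | some true => Q
    | some false => Q' with hν
  set F : (Fin n → Option Bool) → ℝ := fun l => (prSet (pmfPi fun i => ν i (l i)) S).toReal
    with hF
  have hF_swap : ∀ l j, l u₀ ≠ none → l j ≠ none → F (l ∘ Equiv.swap u₀ j) = F l := by
    intro l j hu hj
    rw [hF]
    simp only
    rw [← prSet_pmfPi_comp_perm (fun i => ν i (l i)) (Equiv.swap u₀ j) (hS _)]
    congr 3
    funext i
    have some_eq : ∀ (i k : Fin n) (o : Option Bool), o ≠ none → ν i o = ν k o := by
      rintro i k (_ | _ | _) ho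
      · exact absurd rfl ho
      · rfl
      · rfl
    by_cases hiu : i = u₀
    · subst hiu
      simpa using some_eq _ _ _ hj
    by_cases hij : i = j
    · subst hij
      simpa using some_eq _ _ _ hu
    · simp [Equiv.swap_apply_of_ne_of_ne hiu hij]
  have expand : ∀ (ρ : Fin n → PMF W) (a b : ℝ), 0 ≤ a → 0 ≤ b →
      (∀ w, (ρ u₀ w).toReal = a * (Q w).toReal + b * (Q' w).toReal) →
      (∀ i, i ≠ u₀ → ρ i = μ i) →
      (prSet (pmfPi ρ) S).toReal = ∑ l, (∏ i ∈ Finset.univ.erase u₀, labelWeight E⁻¹ (l i))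
        * labelStat a b (l u₀) * F l := by
    intro ρ a b ha hb hρ hρμ
    set c : Fin n → Option Bool → ℝ := fun i o =>
      if i = u₀ then labelStat a b o else labelWeight E⁻¹ o with hc
    have hc0 : ∀ i o, 0 ≤ c i o := by
      intro i o
      simp only [hc]
      split_ifs
      exacts [labelStat_nonneg ha hb o, labelWeight_nonneg hp0 hp1.le o]
    rw [prSet_pmfPi_mixture ρ (fun i o => ENNReal.ofReal (c i o)) ν, ENNReal.toReal_sum]
    · refine Finset.sum_congr rfl fun l _ => ?_
      rw [ENNReal.toReal_mul, ENNReal.toReal_prod]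
      congr 1
      simp only [ENNReal.toReal_ofReal (hc0 _ _)]
      rw [← Finset.prod_erase_mul _ _ (Finset.mem_univ u₀)]
      congr 1
      · exact Finset.prod_congr rfl fun i hi => if_neg (Finset.ne_of_mem_erase hi)
      · exact if_pos rfl
    · intro l _
      exact ENNReal.mul_ne_top (ENNReal.prod_ne_top fun _ _ => ENNReal.ofReal_ne_top)
        (ne_top_of_le_ne_top ENNReal.one_ne_top (prSet_le_one _ _))
    · intro i w
      have hfin : ∀ o ∈ Finset.univ, ENNReal.ofReal (c i o) * ν i o w ≠ ⊤ := fun o _ =>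
        ENNReal.mul_ne_top ENNReal.ofReal_ne_top (PMF.apply_ne_top _ _)
      rw [← ENNReal.toReal_eq_toReal_iff' (PMF.apply_ne_top _ _) (ENNReal.sum_ne_top.2 hfin),
        ENNReal.toReal_sum hfin]
      simp only [ENNReal.toReal_mul, ENNReal.toReal_ofReal (hc0 _ _)]
      simp only [Fintype.sum_option, Fintype.sum_bool, hν, hc]
      by_cases hi : i = u₀
      · subst hi
        simp [labelStat, hρ]
      · simp only [if_neg hi, labelWeight, hρμ i hi, hP i hi w, hκ]
        ring
  have main := sum_labels_le_swapped u₀ hp0 hp1.le hq2 hq1 hθ0 hθ ht F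
    (fun l => ENNReal.toReal_nonneg)
    (fun l => ENNReal.toReal_mono ENNReal.one_ne_top (prSet_le_one _ _)) hF_swap
  rw [← expand μ q (1 - q) (by linarith) (by linarith) (fun w => by rw [(hQ w).1, hq'])
      fun _ _ => rfl,
    ← expand μ' (1 - q) q (by linarith) (by linarith) (fun w => by rw [(hQ w).2, hq'])
      fun i hi => (hagree i hi).symm, Fintype.card_fin, ← hq3] at main
  exact main

theorem partitionOutput_comp_perm {n : ℕ} {Y : Type*} (σ : Equiv.Perm (Fin n))
    (s : Fin n → Y × Fin n) : partitionOutput (s ∘ σ) = partitionOutput s := by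
  funext v
  have h : (Finset.univ.val : Multiset (Fin n)).map σ = Finset.univ.val := by
    simp
  unfold partitionOutput
  conv_rhs => rw [← h, Multiset.filter_map, Multiset.map_map]
  rfl

theorem prod_law_apply {Y : Type*} {n : ℕ} (r : PMF Y) (d : PMF (Fin n)) (z : Y × Fin n) :
    (r.bind fun y => d.map fun i => (y, i)) z = r z.1 * d z.2 := by
  classical
  obtain ⟨y, i⟩ := z
  rw [PMF.bind_apply, tsum_eq_single y]
  · rw [PMF.map_apply, tsum_eq_single i]
    · simp
    · intro j hj
      simp [hj.symm]
  · intro y' hy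
    rw [PMF.map_apply]
    simp [hy.symm]

theorem prSet_netShuffle {n : ℕ} {X Y : Type*} (R : X → PMF Y) (dest : Fin n → PMF (Fin n))
    (x : Fin n → X) (S : Set (Fin n → Multiset Y)) :
    prSet (netShuffle R dest x) S
      = prSet (pmfPi fun u => (R (x u)).bind fun y => (dest u).map fun i => (y, i))
          (partitionOutput ⁻¹' S) := by
  rw [prSet, prSet, netShuffle, PMF.toOuterMeasure_map_apply]

/-- Changing the destination laws by a bounded ratio changes the output law by a bounded ratio. -/
theorem prSet_netShuffle_le {n : ℕ} {X Y : Type*} (R : X → PMF Y)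
    {dest dest' : Fin n → PMF (Fin n)} {c : ℝ≥0∞} (h : ∀ u i, dest u i ≤ c * dest' u i)
    (x : Fin n → X) (S : Set (Fin n → Multiset Y)) :
    prSet (netShuffle R dest x) S ≤ c ^ n * prSet (netShuffle R dest' x) S := by
  rw [prSet_netShuffle, prSet_netShuffle]
  refine prSet_le_mul_of_le (fun w => ?_) _
  rw [pmfPi_apply, pmfPi_apply]
  calc _ ≤ ∏ i, c * ((R (x i)).bind fun y => (dest' i).map fun j => (y, j)) (w i) := by
        refine Finset.prod_le_prod' fun i _ => ?_
        rw [prod_law_apply, prod_law_apply, mul_left_comm]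
        gcongr
        exact h _ _
    _ = _ := by simp [Finset.prod_mul_distrib]

/-- Privacy amplification when every destination follows the same law. -/
theorem prSet_netShuffle_const_le {n : ℕ} {X Y : Type*} (R : X → PMF Y) {ε₀ : ℝ} (hε₀ : 0 < ε₀)
    (hR : IsLocalDP R ε₀ 0) (d : PMF (Fin n)) {t θ : ℝ} (hθ0 : 0 ≤ θ) (hθ : θ ≤ 1 / 2)
    (ht : 4 * θ ≤ t) {x x' : Fin n → X} (hx : Neighboring x x') (S : Set (Fin n → Multiset Y)) :
    prSet (netShuffle R (fun _ => d) x) S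
      ≤ ENNReal.ofReal (1 + (Real.exp ε₀ - 1) / (Real.exp ε₀ + 1) * t)
          * prSet (netShuffle R (fun _ => d) x') S
        + ENNReal.ofReal (Real.exp (θ - θ ^ 2
          - ((n : ℝ) - 1) * (Real.exp ε₀)⁻¹ * (1 - Real.exp (-(θ ^ 2 / 2))))) := by
  obtain ⟨u₀, hu₀⟩ := hx
  have hE : 1 < Real.exp ε₀ := Real.one_lt_exp_iff.2 hε₀
  have ratio : ∀ a b : X, ∀ w : Y × Fin n,
      (((R a).bind fun y => d.map fun i => (y, i)) w).toReal
        ≤ Real.exp ε₀ * (((R b).bind fun y => d.map fun i => (y, i)) w).toReal := by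
    intro a b w
    rw [prod_law_apply, prod_law_apply, ENNReal.toReal_mul, ENNReal.toReal_mul, ← mul_assoc]
    refine mul_le_mul_of_nonneg_right ?_ ENNReal.toReal_nonneg
    have := hR a b {w.1}
    rw [prSet_singleton, prSet_singleton, ENNReal.ofReal_zero, add_zero] at this
    have := ENNReal.toReal_mono
      (ENNReal.mul_ne_top ENNReal.ofReal_ne_top (PMF.apply_ne_top _ _)) this
    rwa [ENNReal.toReal_mul, ENNReal.toReal_ofReal (Real.exp_pos _).le] at this
  have main := prSet_pmfPi_le_of_perm_invariant
    (fun u => (R (x u)).bind fun y => d.map fun i => (y, i))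
    (fun u => (R (x' u)).bind fun y => d.map fun i => (y, i)) u₀
    (fun u hu => by simp only [hu₀ u hu]) hE (fun i w => ratio _ _ w) (fun i w => ratio _ _ w)
    hθ0 hθ ht (partitionOutput ⁻¹' S)
    (fun σ w => by rw [Set.mem_preimage, Set.mem_preimage, partitionOutput_comp_perm])
  rw [← prSet_netShuffle R (fun _ => d), ← prSet_netShuffle R (fun _ => d)] at main
  have hfin : ∀ z, prSet (netShuffle R (fun _ => d) z) S ≠ ⊤ := fun z =>
    ne_top_of_le_ne_top ENNReal.one_ne_top (prSet_le_one _ _)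
  have hκ : 0 ≤ 1 + (Real.exp ε₀ - 1) / (Real.exp ε₀ + 1) * t :=
    add_nonneg zero_le_one
      (mul_nonneg (div_nonneg (by linarith) (by linarith)) (by linarith))
  rw [← ENNReal.ofReal_toReal (hfin x), ← ENNReal.ofReal_toReal (hfin x'),
    ← ENNReal.ofReal_mul hκ, ← ENNReal.ofReal_add (mul_nonneg hκ ENNReal.toReal_nonneg)
      (Real.exp_pos _).le]
  exact ENNReal.ofReal_le_ofReal main

/-- The Chernoff error term is at most `δ`. -/
theorem chernoff_error_le {n ε₀ δ θ : ℝ} (hn : 1 ≤ n) (hε₀ : 0 < ε₀) (hδ0 : 0 < δ) (hδ1 : δ ≤ 1)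
    (hN : 16 * Real.log (2 / δ) ≤ n / Real.exp ε₀)
    (hθ : θ = 2 * Real.sqrt (Real.log (2 / δ) / (n / Real.exp ε₀))) :
    0 ≤ θ ∧ θ ≤ 1 / 2 ∧
      Real.exp (θ - θ ^ 2 - (n - 1) * (Real.exp ε₀)⁻¹ * (1 - Real.exp (-(θ ^ 2 / 2)))) ≤ δ := by
  set l := Real.log (2 / δ) with hl
  set E := Real.exp ε₀ with hE
  set N := n / E with hNdef
  have hE1 : 1 < E := Real.one_lt_exp_iff.2 hε₀
  have hlog : l = Real.log 2 - Real.log δ := Real.log_div two_ne_zero hδ0.ne'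
  have h2 := Real.log_two_gt_d9
  have hl0 : 0 < l := by
    have := Real.log_nonpos hδ0.le hδ1
    linarith
  have hN0 : 0 < N := by linarith
  have hr : l / N ≤ 1 / 16 := by
    rw [div_le_div_iff₀ hN0 (by norm_num)]
    linarith
  have hr0 : 0 < l / N := div_pos hl0 hN0
  have hs : Real.sqrt (l / N) ≤ 1 / 4 := by
    rw [Real.sqrt_le_left (by norm_num)]
    linarith
  have hs0 := Real.sqrt_nonneg (l / N)
  have hsq : θ ^ 2 / 2 = 2 * (l / N) := by
    rw [hθ, mul_pow, Real.sq_sqrt hr0.le]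
    ring
  refine ⟨by linarith, by linarith, ?_⟩
  rw [hsq]
  set y := 2 * (l / N) with hy
  have hy0 : 0 < y := by linarith
  have hy1 : y ≤ 1 / 8 := by linarith
  have hNy : N * y = 2 * l := by rw [hy]; field_simp
  have hexp : 8 / 9 * y ≤ 1 - Real.exp (-y) := by
    have h3 : Real.exp (-y) ≤ 1 / (1 + y) := by
      rw [Real.exp_neg, ← one_div]
      exact one_div_le_one_div_of_le (by linarith) (by linarith [Real.add_one_le_exp y])
    have h4 : 1 / (1 + y) ≤ 1 - 8 / 9 * y := by
      rw [div_le_iff₀ (by linarith)]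
      nlinarith
    linarith
  have hNE : N - 1 ≤ (n - 1) * E⁻¹ := by
    have : E⁻¹ ≤ 1 := inv_le_one_of_one_le₀ hE1.le
    rw [hNdef, div_eq_mul_inv]
    linarith
  have hN1 : 0 ≤ (n - 1) * E⁻¹ := mul_nonneg (by linarith) (inv_nonneg.2 (by linarith))
  have h5 : (N - 1) * (8 / 9 * y) ≤ (n - 1) * E⁻¹ * (1 - Real.exp (-y)) :=
    mul_le_mul hNE hexp (by linarith) hN1
  have h6 : θ - θ ^ 2 ≤ 1 / 4 := by nlinarith [sq_nonneg (θ - 1 / 2)]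
  rw [← Real.le_log_iff_exp_le hδ0]
  nlinarith

theorem exists_pmf_statDist {n : ℕ} (G : SimpleGraph (Fin n)) [DecidableRel G.Adj]
    (h : ∃ v, statDist G v ≠ 0) :
    ∃ d : PMF (Fin n), ∀ i, d i = ENNReal.ofReal (statDist G i) := by
  have hm : (2 * (G.edgeFinset.card : ℝ)) ≠ 0 := by
    obtain ⟨v, hv⟩ := h
    exact (div_ne_zero_iff.1 hv).2
  have hsum : ∑ i, statDist G i = 1 := by
    unfold statDist
    rw [← Finset.sum_div, div_eq_one_iff_eq hm]
    exact_mod_cast G.sum_degrees_eq_twice_card_edges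
  refine ⟨PMF.ofFintype (fun i => ENNReal.ofReal (statDist G i)) ?_, fun i => rfl⟩
  rw [← ENNReal.ofReal_sum_of_nonneg, hsum, ENNReal.ofReal_one]
  intro i _
  exact div_nonneg (Nat.cast_nonneg _) (by positivity)

/-- After `T` rounds the position is within `ε₀ / n ^ 4` of stationarity. -/
theorem abs_walkVec_sub_statDist_le {n : ℕ} (hn : 1 ≤ n) {ε₀ α : ℝ} (hε₀ : 0 < ε₀)
    (G : SimpleGraph (Fin n)) [DecidableRel G.Adj] (hα : α ∈ Set.Ioo (0 : ℝ) 1)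
    (hmix : MixHyp G α) {T : ℕ}
    (hT : (1 / α) * Real.log ((n : ℝ) ^ (4.5 : ℝ) / ε₀) ≤ (T : ℝ)) (u i : Fin n) :
    |walkVec G T u i - statDist G i| ≤ ε₀ / (n : ℝ) ^ 4 := by
  have hn0 : (0 : ℝ) < n := by exact_mod_cast hn
  have hx : 0 < (n : ℝ) ^ (4.5 : ℝ) / ε₀ := by positivity
  have h1 : |walkVec G T u i - statDist G i| ≤ Real.sqrt n * (1 - α) ^ T :=
    (Finset.single_le_sum (f := fun i => |walkVec G T u i - statDist G i|)
      (fun j _ => abs_nonneg _) (Finset.mem_univ i)).trans (hmix u T)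
  have h2 : (1 - α) ^ T ≤ ε₀ / (n : ℝ) ^ (4.5 : ℝ) := by
    calc (1 - α) ^ T ≤ Real.exp (-α) ^ T :=
          pow_le_pow_left₀ (by linarith [hα.2]) (Real.one_sub_le_exp_neg α) T
      _ = Real.exp (-(T * α)) := by rw [← Real.exp_nat_mul]; ring_nf
      _ ≤ Real.exp (-Real.log ((n : ℝ) ^ (4.5 : ℝ) / ε₀)) := by
          rw [Real.exp_le_exp, neg_le_neg_iff]
          rwa [one_div, inv_mul_le_iff₀ hα.1, mul_comm] at hT
      _ = ε₀ / (n : ℝ) ^ (4.5 : ℝ) := by rw [Real.exp_neg, Real.exp_log hx, inv_div]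
  have h3 : (n : ℝ) ^ (4.5 : ℝ) = Real.sqrt n * (n : ℝ) ^ 4 := by
    rw [Real.sqrt_eq_rpow, ← Real.rpow_natCast, ← Real.rpow_add hn0]
    norm_num
  refine h1.trans ((mul_le_mul_of_nonneg_left h2 (Real.sqrt_nonneg _)).trans_eq ?_)
  have : Real.sqrt n ≠ 0 := (Real.sqrt_pos.2 hn0).ne'
  rw [h3]
  field_simp

theorem ratio_of_abs_sub_le {n ε₀ p π : ℝ} (hn : 3 ≤ n) (hε₀ : 0 < ε₀) (hεn : ε₀ ≤ n)
    (hπ : 2 / (n * (n - 2)) ≤ π) (h : |p - π| ≤ ε₀ / n ^ 4) :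
    p ≤ Real.exp (ε₀ / (2 * n ^ 2)) * π ∧ π ≤ Real.exp (ε₀ / (2 * n ^ 2)) * p := by
  have hn0 : 0 < n := by linarith
  have hn2 : 0 < n - 2 := by linarith
  set y := ε₀ / (2 * n ^ 2) with hy
  have hy0 : 0 < y := by positivity
  have hyn : y ≤ 1 / (2 * n) := by
    rw [hy, div_le_div_iff₀ (by positivity) (by positivity)]
    nlinarith
  set η := y * ((n - 2) / n) with hη
  have hη0 : 0 < η := by positivity
  have hηy : η = y - y * (2 / n) := by rw [hη]; field_simp
  have hb : ε₀ / n ^ 4 ≤ η * π := by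
    calc ε₀ / n ^ 4 = η * (2 / (n * (n - 2))) := by rw [hη, hy]; field_simp
      _ ≤ η * π := mul_le_mul_of_nonneg_left hπ hη0.le
  have hπ0 : 0 < π := lt_of_lt_of_le (by positivity) hπ
  obtain ⟨h1, h2⟩ := abs_le.1 (h.trans hb)
  have he := Real.add_one_le_exp y
  have hη1 : η ≤ y := by
    have : 0 ≤ y * (2 / n) := by positivity
    linarith
  have hη2 : η ≤ 2 / n := hη1.trans (hyn.trans (by
    rw [div_le_div_iff₀ (by positivity) hn0]; nlinarith))
  constructor
  · nlinarith
  · have hp : (1 - η) * π ≤ p := by linarith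
    have hp0 : 0 ≤ p := by
      refine le_trans (mul_nonneg ?_ hπ0.le) hp
      have : 1 / (2 * n) ≤ 1 := by
        rw [div_le_one (by positivity)]; linarith
      linarith
    have h3 : 1 ≤ (1 + y) * (1 - η) := by
      have : y * η ≤ y * (2 / n) := mul_le_mul_of_nonneg_left hη2 hy0.le
      nlinarith
    calc π ≤ (1 + y) * (1 - η) * π := le_mul_of_one_le_left hπ0.le h3
      _ = (1 + y) * ((1 - η) * π) := mul_assoc _ _ _
      _ ≤ Real.exp y * p := by
        rw [add_comm 1 y]
        exact mul_le_mul he hp (mul_nonneg (by nlinarith) hπ0.le) (Real.exp_pos _).le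

/-- Theorem 1, pure-DP case: privacy amplification by the network shuffle
`A_rnd-wlk` for an `ε₀`-DP local randomizer. -/
theorem networkShuffle_privacy_amplification_pure
    {X Y : Type*} {n : ℕ} (hn : 3 ≤ n)
    (R : X → PMF Y) (ε₀ : ℝ) (hε₀ : 0 < ε₀) (hR : IsLocalDP R ε₀ 0)
    (G : SimpleGraph (Fin n)) [DecidableRel G.Adj]
    (hconn : G.Connected) (hnonbip : ¬ G.Colorable 2)
    (α : ℝ) (hα : α ∈ Set.Ioo (0 : ℝ) 1) (hmix : MixHyp G α)
    (hπ : ∀ v : Fin n, 2 / ((n : ℝ) * ((n : ℝ) - 2)) ≤ statDist G v)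
    (T : ℕ) (hT : (1 / α) * Real.log ((n : ℝ) ^ (4.5 : ℝ) / ε₀) ≤ (T : ℝ))
    (dest : Fin n → PMF (Fin n))
    (hdest : ∀ u i, dest u i = ENNReal.ofReal (walkVec G T u i))
    (δ : ℝ) (hδ : δ ∈ Set.Icc (0 : ℝ) 1)
    (hεδ : ε₀ ≤ Real.log ((n : ℝ) / (16 * Real.log (2 / δ))))
    (ε : ℝ)
    (hε : ε = ε₀ / n + Real.log (1 + ((Real.exp ε₀ - 1) / (Real.exp ε₀ + 1)) *
        (8 * Real.sqrt (Real.exp ε₀ * Real.log (4 / δ)) / Real.sqrt n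
          + 8 * Real.exp ε₀ / n))) :
    IsDP (netShuffle R dest) ε (Real.exp (ε₀ / (2 * n)) * δ) := by
  have hn3 : (3 : ℝ) ≤ n := by exact_mod_cast hn
  have hn0 : (0 : ℝ) < n := by linarith
  have hδ0 : 0 < δ := by
    refine lt_of_le_of_ne hδ.1 fun h => ?_
    rw [← h] at hεδ
    simp at hεδ
    linarith
  have hl0 : 0 < Real.log (2 / δ) := Real.log_pos (by
    rw [lt_div_iff₀ hδ0]
    linarith [hδ.2])
  have hE1 : 1 < Real.exp ε₀ := Real.one_lt_exp_iff.2 hε₀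
  have hexp : Real.exp ε₀ ≤ n / (16 * Real.log (2 / δ)) :=
    (Real.le_log_iff_exp_le (by positivity)).1 hεδ
  have hN : 16 * Real.log (2 / δ) ≤ n / Real.exp ε₀ := by
    rw [le_div_iff₀ (Real.exp_pos _), mul_comm]
    rwa [le_div_iff₀ (by positivity)] at hexp
  have hεn : ε₀ ≤ n := by
    have h1 := Real.add_one_le_exp ε₀
    have h2 : Real.log 2 ≤ Real.log (2 / δ) :=
      Real.log_le_log two_pos (by rw [le_div_iff₀ hδ0]; linarith [hδ.2])
    have h3 := Real.log_two_gt_d9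
    rw [le_div_iff₀ (by positivity)] at hexp
    nlinarith
  obtain ⟨d, hd⟩ := exists_pmf_statDist G ⟨⟨0, by omega⟩, by
    refine (lt_of_lt_of_le ?_ (hπ _)).ne'
    have : 0 < (n : ℝ) - 2 := by linarith
    positivity⟩
  set y := ε₀ / (2 * (n : ℝ) ^ 2) with hy
  have hratio := fun u i => ratio_of_abs_sub_le hn3 hε₀ hεn (hπ i)
    (abs_walkVec_sub_statDist_le (by omega) hε₀ G hα hmix hT u i)
  have hdest_le : ∀ u i, dest u i ≤ ENNReal.ofReal (Real.exp y) * d i := fun u i => by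
    rw [hdest, hd, ← ENNReal.ofReal_mul (Real.exp_pos _).le]
    exact ENNReal.ofReal_le_ofReal (hratio u i).1
  have hle_dest : ∀ u i, d i ≤ ENNReal.ofReal (Real.exp y) * dest u i := fun u i => by
    rw [hdest, hd, ← ENNReal.ofReal_mul (Real.exp_pos _).le]
    exact ENNReal.ofReal_le_ofReal (hratio u i).2
  have hpow : ENNReal.ofReal (Real.exp y) ^ n = ENNReal.ofReal (Real.exp (ε₀ / (2 * n))) := by
    rw [← ENNReal.ofReal_pow (Real.exp_pos _).le, ← Real.exp_nat_mul]
    congr 2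
    rw [hy]
    field_simp
  set θ := 2 * Real.sqrt (Real.log (2 / δ) / (n / Real.exp ε₀)) with hθ
  obtain ⟨hθ0, hθ1, herr⟩ := chernoff_error_le (by linarith) hε₀ hδ0 hδ.2 hN hθ
  set t := 8 * Real.sqrt (Real.exp ε₀ * Real.log (4 / δ)) / Real.sqrt n
          + 8 * Real.exp ε₀ / n with ht
  have hθt : 4 * θ ≤ t := by
    have h1 : Real.sqrt (Real.log (2 / δ) / (n / Real.exp ε₀))
        ≤ Real.sqrt (Real.exp ε₀ * Real.log (4 / δ)) / Real.sqrt n := by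
      rw [← Real.sqrt_div' _ hn0.le, div_div_eq_mul_div, mul_comm]
      gcongr
      norm_num
    have h2 : 0 ≤ 8 * Real.exp ε₀ / n := by positivity
    rw [hθ, ht, mul_div_assoc]
    linarith
  have ht0 : 0 ≤ (Real.exp ε₀ - 1) / (Real.exp ε₀ + 1) * t :=
    mul_nonneg (div_nonneg (by linarith) (by linarith)) (by linarith)
  have hexpε : Real.exp ε = Real.exp (ε₀ / (2 * n))
      * (1 + (Real.exp ε₀ - 1) / (Real.exp ε₀ + 1) * t) * Real.exp (ε₀ / (2 * n)) := by
    have : ε₀ / (n : ℝ) = ε₀ / (2 * n) + ε₀ / (2 * n) := by field_simp; ring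
    rw [hε, Real.exp_add, Real.exp_log (by linarith), this, Real.exp_add]
    ring
  intro x x' hx S
  set c := Real.exp (ε₀ / (2 * n)) with hc
  have hc0 : 0 ≤ c := (Real.exp_pos _).le
  set κ := 1 + (Real.exp ε₀ - 1) / (Real.exp ε₀ + 1) * t with hκ
  have hκ0 : 0 ≤ κ := by linarith
  calc prSet (netShuffle R dest x) S
      ≤ ENNReal.ofReal c * prSet (netShuffle R (fun _ => d) x) S := by
        rw [← hpow]
        exact prSet_netShuffle_le R hdest_le x S
    _ ≤ ENNReal.ofReal c * (ENNReal.ofReal κ * prSet (netShuffle R (fun _ => d) x') S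
          + ENNReal.ofReal δ) := by
        gcongr
        refine (prSet_netShuffle_const_le R hε₀ hR d hθ0 hθ1 hθt hx S).trans ?_
        gcongr
    _ ≤ ENNReal.ofReal c * (ENNReal.ofReal κ * (ENNReal.ofReal c * prSet (netShuffle R dest x') S)
          + ENNReal.ofReal δ) := by
        gcongr
        rw [← hpow]
        exact prSet_netShuffle_le R hle_dest x' S
    _ = _ := by
        rw [hexpε, ENNReal.ofReal_mul (mul_nonneg hc0 hκ0), ENNReal.ofReal_mul hc0,
          ENNReal.ofReal_mul hc0]
        ring

end
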